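/- Let Ω ⊂ ℝ² be a compact convex set with 0 in its interior and Ω° := {q ∈ ℝ² : ⟨q,x⟩ ≤ 1 for all x ∈ Ω} its polar set. For every p in the frontier of Ω and every q in the frontier of Ω°, the following are equivalent: (1) ⟨q,x⟩ ≤ ⟨q,p⟩ for every x ∈ Ω (q determines a supporting half-plane of Ω at p); (2) ⟨p,q⟩ = 1 (the Pythagorean equality of convex trigonometry); (3) ⟨p,y⟩ ≤ ⟨p,q⟩ for every y ∈ Ω° (p determines a supporting half-plane of Ω° at q). In particular the correspondence θ ↔ ψ between angles of Ω and Ω° is symmetric. -/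

import Mathlib

open MeasureTheory

/-- The Euclidean pairing on `ℝ × ℝ`. -/
def dot2 (p q : ℝ × ℝ) : ℝ := p.1 * q.1 + p.2 * q.2

/-- The polar set of a subset of `ℝ²`. -/
def polar2 (K : Set (ℝ × ℝ)) : Set (ℝ × ℝ) := {q | ∀ x ∈ K, dot2 q x ≤ 1}

/-- An area parametrization of the boundary of `K`: a locally Lipschitz curve tracing
`frontier K` which sweeps area at unit rate, i.e. `R₁ R₂′ − R₂ R₁′ = 1` a.e.
(equivalently `R θ = (cos_K θ, sin_K θ)` in the paper's convex trigonometry). -/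
structure IsAreaParam (K : Set (ℝ × ℝ)) (R : ℝ → ℝ × ℝ) : Prop where
  lipschitz : LocallyLipschitz R
  mem_frontier : ∀ θ, R θ ∈ frontier K
  area : ∀ᵐ θ : ℝ ∂volume, ∃ v : ℝ × ℝ, HasDerivAt R v θ ∧ (R θ).1 * v.2 - (R θ).2 * v.1 = 1

theorem dot2_comm (p q : ℝ × ℝ) : dot2 p q = dot2 q p := by
  simp only [dot2]; ring

theorem continuous_dot2 : Continuous fun z : (ℝ × ℝ) × (ℝ × ℝ) => dot2 z.1 z.2 := by
  unfold dot2; fun_prop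

theorem isClosed_polar2 (K : Set (ℝ × ℝ)) : IsClosed (polar2 K) := by
  have h : polar2 K = ⋂ x ∈ K, {q | dot2 q x ≤ 1} := by
    ext q; simp [polar2]
  rw [h]
  exact isClosed_biInter fun x _ =>
    isClosed_le (continuous_dot2.comp (by fun_prop : Continuous fun q : ℝ × ℝ => (q, x)))
      continuous_const

/-- A point pairing to less than `1` with every point of a compact set is interior to its polar. -/
theorem mem_interior_polar2 {K : Set (ℝ × ℝ)} (hK : IsCompact K) {q : ℝ × ℝ}
    (hq : ∀ x ∈ K, dot2 q x < 1) : q ∈ interior (polar2 K) := by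
  rw [mem_interior_iff_mem_nhds]
  have h := hK.eventually_forall_of_forall_eventually (x₀ := q)
    (P := fun y x => dot2 y x < 1) fun x hx =>
      continuous_dot2.continuousAt.eventually_lt continuousAt_const (hq x hx)
  filter_upwards [h] with y hy x hx using (hy x hx).le

theorem exists_dot2_eq_one_of_mem_frontier_polar2 {K : Set (ℝ × ℝ)} (hK : IsCompact K)
    {q : ℝ × ℝ} (hq : q ∈ frontier (polar2 K)) : ∃ x ∈ K, dot2 q x = 1 := by
  by_contra! h
  have hmem : q ∈ polar2 K := (isClosed_polar2 K).frontier_subset hq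
  exact hq.2 (mem_interior_polar2 hK fun x hx => lt_of_le_of_ne (hmem x hx) (h x hx))

/-- Through every frontier point of a convex set with `0` in its interior there is a supporting
line given by an element of the polar set. -/
theorem exists_mem_polar2_dot2_eq_one {K : Set (ℝ × ℝ)} (hK : Convex ℝ K)
    (h0 : ((0, 0) : ℝ × ℝ) ∈ interior K) {p : ℝ × ℝ} (hp : p ∈ frontier K) :
    ∃ y ∈ polar2 K, dot2 y p = 1 := by
  obtain ⟨f, hf⟩ := geometric_hahn_banach_open_point hK.interior isOpen_interior hp.2
  have hpos : 0 < f p := by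
    have h := hf _ h0
    rwa [Prod.mk_zero_zero, map_zero] at h
  have hle : ∀ x ∈ K, f x ≤ f p := by
    intro x hx
    have hx' : x ∈ closure (interior K) := by
      rw [hK.closure_interior_eq_closure_of_nonempty_interior ⟨_, h0⟩]
      exact subset_closure hx
    exact closure_minimal (fun a ha => (hf a ha).le)
      (isClosed_le f.continuous continuous_const) hx'
  have hdot : ∀ x, dot2 (f (1, 0) / f p, f (0, 1) / f p) x = f x / f p := by
    intro x
    have hx : x = x.1 • ((1, 0) : ℝ × ℝ) + x.2 • ((0, 1) : ℝ × ℝ) := by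
      ext <;> simp
    have hfx : f x = x.1 * f (1, 0) + x.2 * f (0, 1) := by
      conv_lhs => rw [hx]
      simp only [map_add, map_smul, smul_eq_mul]
    rw [hfx, dot2]
    ring
  refine ⟨(f (1, 0) / f p, f (0, 1) / f p), fun x hx => ?_, ?_⟩
  · rw [hdot, div_le_one hpos]
    exact hle x hx
  · rw [hdot, div_self hpos.ne']

/-- Duality of supporting half-planes and the Pythagorean equality of convex
trigonometry: for `p ∈ ∂Ω` and `q ∈ ∂Ω°`, `q` supports `Ω` at `p` iff `⟨p,q⟩ = 1`
iff `p` supports `Ω°` at `q`. -/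
theorem polar_duality_correspondence
    (Ω : Set (ℝ × ℝ)) (hΩc : IsCompact Ω) (hΩconv : Convex ℝ Ω)
    (hΩ0 : ((0, 0) : ℝ × ℝ) ∈ interior Ω)
    (p q : ℝ × ℝ) (hp : p ∈ frontier Ω) (hq : q ∈ frontier (polar2 Ω)) :
    ((∀ x ∈ Ω, dot2 q x ≤ dot2 q p) ↔ dot2 p q = 1) ∧
      (dot2 p q = 1 ↔ ∀ y ∈ polar2 Ω, dot2 p y ≤ dot2 p q) := by
  have hpΩ : p ∈ Ω := hΩc.isClosed.frontier_subset hp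
  have hqΩ : q ∈ polar2 Ω := (isClosed_polar2 Ω).frontier_subset hq
  have hle : dot2 p q ≤ 1 := dot2_comm p q ▸ hqΩ p hpΩ
  refine ⟨⟨fun h => ?_, fun h x hx => ?_⟩, ⟨fun h y hy => ?_, fun h => ?_⟩⟩
  · obtain ⟨x, hx, hqx⟩ := exists_dot2_eq_one_of_mem_frontier_polar2 hΩc hq
    refine le_antisymm hle ?_
    rw [← hqx, dot2_comm p q]
    exact h x hx
  · rw [dot2_comm q p, h]
    exact hqΩ x hx
  · rw [h, dot2_comm]
    exact hy p hpΩ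
  · obtain ⟨y, hy, hyp⟩ := exists_mem_polar2_dot2_eq_one hΩconv hΩ0 hp
    refine le_antisymm hle ?_
    rw [← hyp, dot2_comm y p]
    exact h y hy
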